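/- Let W_Z(x) := Z/(2π(1+|x|²)^{3/2}) for x ∈ ℝ² and Z > 0. Then the half-Laplacian of W_Z is (-Δ)^{1/2} W_Z(x) = Z(2-|x|²)/(2π(1+|x|²)^{5/2}), which is a sign-changing function on ℝ². -/

import Mathlib

open Real MeasureTheory

lemma cs_pos (a : ℝ) (ha : 0 < a) :
    ∫ x in Set.Ioi (0:ℝ), rexp (-(x^2 + a^2/x^2)) = √π / 2 * rexp (-2*a) := by
  set f : ℝ → ℝ := fun x => x - a / x with hf
  set g : ℝ → ℝ := fun x => rexp (-x^2) with hg
  have hd : ∀ x ∈ Set.Ioi (0:ℝ), HasDerivWithinAt f (1 + a/x^2) (Set.Ioi 0) x := by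
    intro x hx
    have hx0 : x ≠ 0 := (Set.mem_Ioi.1 hx).ne'
    have := ((hasDerivAt_id x).sub ((hasDerivAt_inv hx0).const_mul a)).hasDerivWithinAt (s := Set.Ioi 0)
    refine HasDerivWithinAt.congr_deriv this ?_
    field_simp
    ring
  have hinj : Set.InjOn f (Set.Ioi 0) := by
    intro x hx y hy hxy
    have hx0 : 0 < x := hx
    have hy0 : 0 < y := hy
    simp only [hf] at hxy
    have h2 : (x - y) * (x*y + a) = 0 := by
      field_simp at hxy
      linear_combination hxy
    rcases mul_eq_zero.1 h2 with h | h
    · linarith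
    · nlinarith [mul_pos hx0 hy0]
  have himg : f '' Set.Ioi 0 = Set.univ := by
    ext u
    simp only [Set.mem_image, Set.mem_univ, iff_true]
    have hs : √(u^2+4*a)^2 = u^2+4*a := Real.sq_sqrt (by positivity)
    have hpos : 0 < (u + √(u^2+4*a))/2 := by
      have : |u| < √(u^2+4*a) := by
        rw [← Real.sqrt_sq_eq_abs]
        exact Real.sqrt_lt_sqrt (by positivity) (by linarith)
      have := neg_abs_le u
      linarith
    refine ⟨_, hpos, ?_⟩
    simp only [hf]
    have hne : u + √(u^2+4*a) ≠ 0 := by linarith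
    field_simp
    linear_combination hs
  have hgauss : ∫ x, g x = √π := by
    have := integral_gaussian 1
    simpa [hg] using this
  have hgint : Integrable g := by
    have := integrable_exp_neg_mul_sq (b := 1) one_pos
    simpa [hg] using this
  have e1 := integral_image_eq_integral_abs_deriv_smul measurableSet_Ioi hd hinj g
  have i1 := (integrableOn_image_iff_integrableOn_abs_deriv_smul measurableSet_Ioi hd hinj g).1
    (by rw [himg]; exact hgint.integrableOn)
  rw [himg, setIntegral_univ, hgauss] at e1
  -- inversion
  have hd2 : ∀ x ∈ Set.Ioi (0:ℝ), HasDerivWithinAt (fun x => a / x) (-(a/x^2)) (Set.Ioi 0) x := by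
    intro x hx
    have hx0 : x ≠ 0 := (Set.mem_Ioi.1 hx).ne'
    have := ((hasDerivAt_inv hx0).const_mul a).hasDerivWithinAt (s := Set.Ioi 0)
    refine HasDerivWithinAt.congr_deriv this ?_
    field_simp
  have hinj2 : Set.InjOn (fun x => a / x) (Set.Ioi 0) := by
    intro x hx y hy hxy
    have hx0 : 0 < x := hx
    have hy0 : 0 < y := hy
    simp only at hxy
    field_simp at hxy
    exact hxy.symm
  have himg2 : (fun x => a / x) '' Set.Ioi 0 = Set.Ioi 0 := by
    ext u
    constructor
    · rintro ⟨x, hx, rfl⟩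
      exact div_pos ha hx
    · intro hu
      have hu0 : 0 < u := hu
      exact ⟨a / u, div_pos ha hu, by simp only; field_simp⟩
  have e2 := integral_image_eq_integral_abs_deriv_smul measurableSet_Ioi hd2 hinj2 (fun x => g (f x))
  have i2 : IntegrableOn (fun x => g (f x)) (Set.Ioi 0) := by
    refine Integrable.mono' i1 ?_ ?_
    · apply Measurable.aestronglyMeasurable
      simp only [hg, hf]
      fun_prop
    · filter_upwards [ae_restrict_mem measurableSet_Ioi] with x hx
      have hx0 : 0 < x := hx
      have h1 : 1 ≤ |1 + a/x^2| := by
        rw [abs_of_pos (by positivity)]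
        have : 0 < a / x^2 := by positivity
        linarith
      have h2 : 0 < g (f x) := Real.exp_pos _
      rw [Real.norm_of_nonneg h2.le, smul_eq_mul]
      nlinarith
  have i3 := (integrableOn_image_iff_integrableOn_abs_deriv_smul measurableSet_Ioi hd2 hinj2 (fun x => g (f x))).1
    (by rw [himg2]; exact i2)
  rw [himg2] at e2
  have e3 : √π = (∫ x in Set.Ioi 0, g (f x)) + ∫ x in Set.Ioi 0, g (f x) := by
    conv_rhs => rw [e2]
    rw [e1]
    conv_rhs => 
      arg 2
      rw [← e2]
    rw [add_comm, ← integral_add i2 i3]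
    refine setIntegral_congr_fun measurableSet_Ioi ?_
    intro x hx
    have hx0 : 0 < x := hx
    have h3 : g (f (a/x)) = g (f x) := by
      simp only [hg, hf]
      congr 1
      field_simp
      ring
    simp only [smul_eq_mul, h3]
    rw [abs_of_pos (by positivity), abs_neg, abs_of_pos (by positivity)]
    ring
  have e4 : ∫ x in Set.Ioi (0:ℝ), rexp (-(x^2 + a^2/x^2)) = ∫ x in Set.Ioi (0:ℝ), g (f x) * rexp (-2*a) := by
    refine setIntegral_congr_fun measurableSet_Ioi ?_
    intro x hx
    have hx0 : 0 < x := hx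
    simp only [hg, hf]
    rw [← Real.exp_add]
    congr 1
    field_simp
    ring
  rw [e4, integral_mul_const]
  congr 1
  linarith

lemma cs (a : ℝ) (ha : 0 ≤ a) :
    ∫ x in Set.Ioi (0:ℝ), rexp (-(x^2 + a^2/x^2)) = √π / 2 * rexp (-2*a) := by
  rcases ha.eq_or_lt with rfl | h
  · have := integral_gaussian_Ioi 1
    simpa using this
  · exact cs_pos a h


lemma rad_int (t : ℝ) (ht : 0 < t) (k : ℕ) :
    Integrable (fun v : EuclideanSpace ℝ (Fin 2) => ‖v‖^k * rexp (-2*π*t*‖v‖)) := by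
  have h := (integrable_fun_norm_addHaar (volume : Measure (EuclideanSpace ℝ (Fin 2)))
    (f := fun r => r^k * rexp (-2*π*t*r))).2
  refine h ?_
  have h2 := integrableOn_rpow_mul_exp_neg_mul_rpow (p := 1) (s := (k+1 : ℝ)) (b := 2*π*t)
    (by have : (0:ℝ) ≤ k := by positivity
        linarith) one_pos (by positivity)
  refine h2.congr_fun ?_ measurableSet_Ioi
  intro x hx
  have hx0 : 0 < x := hx
  simp only [finrank_euclideanSpace, Fintype.card_fin, smul_eq_mul, rpow_one]
  have : x ^ (k + 1 : ℝ) = x^(k+1) := by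
    rw [← Real.rpow_natCast]; push_cast; rfl
  rw [this]
  norm_num
  ring_nf

lemma gauss_int (b : ℝ) (hb : 0 < b) :
    Integrable (fun v : EuclideanSpace ℝ (Fin 2) => rexp (-b*‖v‖^2)) := by
  have := (GaussianFourier.integrable_cexp_neg_mul_sq_norm_add (b := (b:ℂ)) (by simpa using hb) 0
    (0 : EuclideanSpace ℝ (Fin 2))).re
  refine this.congr (Filter.Eventually.of_forall fun v => ?_)
  simp only [zero_mul, add_zero]
  rw [← Complex.ofReal_pow, ← Complex.ofReal_neg, ← Complex.ofReal_mul, ← Complex.ofReal_exp]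
  exact Complex.ofReal_re _

lemma sq_gauss_int (b : ℝ) (hb : 0 < b) :
    ∫ s in Set.Ioi (0:ℝ), s^2 * rexp (-b * s^2) = √π / 4 * b ^ (-(3/2) : ℝ) := by
  have := integral_rpow_mul_exp_neg_mul_rpow (p := 2) (q := 2) (b := b) (by norm_num) (by norm_num) hb
  have hG : Real.Gamma ((2+1)/2) = √π / 2 := by
    have h := Real.Gamma_add_one (s := 1/2) (by norm_num)
    rw [Real.Gamma_one_half_eq] at h
    rw [← show (1/2 + 1 : ℝ) = (2+1)/2 by norm_num, h]
    ring
  rw [hG] at this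
  simp only [Real.rpow_two] at this
  rw [this]
  rw [show (-(2+1)/2 : ℝ) = -(3/2) by norm_num]
  ring

lemma fubini_int (t : ℝ) (ht : 0 < t) (w : EuclideanSpace ℝ (Fin 2)) :
    Integrable (Function.uncurry fun (v : EuclideanSpace ℝ (Fin 2)) (s : ℝ) =>
      Complex.exp ((↑(-2 * π * inner ℝ v w) * Complex.I)) * (rexp (-(s^2 + (π*t*‖v‖)^2/s^2)) : ℂ))
      (volume.prod (volume.restrict (Set.Ioi 0))) := by
  have key : ∀ s : ℝ, 0 < s → ∀ v : EuclideanSpace ℝ (Fin 2),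
      ‖Complex.exp ((↑(-2 * π * inner ℝ v w) * Complex.I)) * (rexp (-(s^2 + (π*t*‖v‖)^2/s^2)) : ℂ)‖
      = rexp (-s^2) * rexp (-(π^2*t^2/s^2)*‖v‖^2) := by
    intro s hs v
    rw [norm_mul, Complex.norm_exp_ofReal_mul_I, one_mul, Complex.norm_real,
      Real.norm_of_nonneg (Real.exp_pos _).le, ← Real.exp_add]
    congr 1
    ring
  have hm : Measurable (Function.uncurry fun (v : EuclideanSpace ℝ (Fin 2)) (s : ℝ) =>
      Complex.exp ((↑(-2 * π * inner ℝ v w) * Complex.I)) * (rexp (-(s^2 + (π*t*‖v‖)^2/s^2)) : ℂ)) := by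
    unfold Function.uncurry
    fun_prop
  rw [integrable_prod_iff' hm.aestronglyMeasurable]
  constructor
  · filter_upwards [ae_restrict_mem measurableSet_Ioi] with s hs
    have hs0 : 0 < s := hs
    refine Integrable.mono' ((gauss_int (π^2*t^2/s^2) (by positivity)).const_mul (rexp (-s^2))) ?_ ?_
    · exact (hm.comp measurable_prodMk_right).aestronglyMeasurable
    · exact Filter.Eventually.of_forall fun v => (key s hs0 v).le
  · have h1 : IntegrableOn (fun s : ℝ => (1/(π*t^2)) * (s^2 * rexp (-1 * s^2))) (Set.Ioi 0) := by
      have := (integrableOn_rpow_mul_exp_neg_mul_sq (b := 1) one_pos (s := 2) (by norm_num))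
      simp only [Real.rpow_two] at this
      exact this.const_mul _
    refine h1.congr_fun ?_ measurableSet_Ioi
    intro s hs
    have hs0 : 0 < s := hs
    simp only [Function.uncurry]
    simp_rw [key s hs0]
    rw [integral_const_mul, GaussianFourier.integral_rexp_neg_mul_sq_norm (by positivity)]
    simp only [finrank_euclideanSpace, Fintype.card_fin]
    norm_num
    field_simp

noncomputable def PK (t : ℝ) (x : EuclideanSpace ℝ (Fin 2)) : ℝ :=
  t / (2 * π * (t^2 + ‖x‖ ^ 2) ^ ((3 : ℝ) / 2))

open FourierTransform in
lemma fourier_E (t : ℝ) (ht : 0 < t) (w : EuclideanSpace ℝ (Fin 2)) :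
    𝓕 (fun v : EuclideanSpace ℝ (Fin 2) => (rexp (-2*π*t*‖v‖) : ℂ)) w = PK t w := by
  rw [Real.fourier_eq']
  have h1 : ∀ v : EuclideanSpace ℝ (Fin 2), (rexp (-2*π*t*‖v‖) : ℂ) =
      ((2 / √π : ℝ) : ℂ) * ∫ s in Set.Ioi (0:ℝ), (rexp (-(s^2 + (π*t*‖v‖)^2/s^2)) : ℂ) := by
    intro v
    rw [integral_complex_ofReal, cs _ (by positivity), ← Complex.ofReal_mul]
    congr 1
    have : √π ≠ 0 := by positivity
    field_simp
  simp_rw [h1, smul_eq_mul, mul_left_comm _ ((2 / √π : ℝ) : ℂ), integral_const_mul,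
    ← integral_const_mul (Complex.exp _)]
  rw [integral_integral_swap (fubini_int t ht w)]
  have h2 : ∫ s in Set.Ioi (0:ℝ), ∫ v : EuclideanSpace ℝ (Fin 2),
      Complex.exp ((↑(-2 * π * inner ℝ v w) * Complex.I)) * (rexp (-(s^2 + (π*t*‖v‖)^2/s^2)) : ℂ)
      = ∫ s in Set.Ioi (0:ℝ), (((1/(π*t^2)) * (s^2 * rexp (-((t^2+‖w‖^2)/t^2) * s^2)) : ℝ) : ℂ) := by
    refine setIntegral_congr_fun measurableSet_Ioi ?_
    intro s hs
    have hs0 : 0 < s := hs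
    have hg := fourier_gaussian_innerProductSpace (b := ((π^2*t^2/s^2 : ℝ) : ℂ))
      (by rw [Complex.ofReal_re]; positivity) w
    rw [Real.fourier_eq'] at hg
    simp only [smul_eq_mul] at hg
    have h3 : ∀ v : EuclideanSpace ℝ (Fin 2), Complex.exp ((↑(-2 * π * inner ℝ v w) * Complex.I)) * (rexp (-(s^2 + (π*t*‖v‖)^2/s^2)) : ℂ)
      = (rexp (-s^2) : ℂ) * (Complex.exp ((↑(-2 * π * inner ℝ v w) * Complex.I)) * Complex.exp (-((π^2*t^2/s^2 : ℝ) : ℂ) * ‖v‖^2)) := by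
      intro v
      rw [mul_left_comm]
      congr 1
      rw [Complex.ofReal_exp, Complex.ofReal_exp, ← Complex.exp_add]
      congr 1
      push_cast
      ring
    simp only
    simp_rw [h3]
    rw [integral_const_mul, hg]
    simp only [finrank_euclideanSpace, Fintype.card_fin]
    norm_num
    rw [mul_left_comm, ← Complex.exp_add]
    have hs' : (s:ℂ) ≠ 0 := by exact_mod_cast hs0.ne'
    have ht' : (t:ℂ) ≠ 0 := by exact_mod_cast ht.ne'
    have hp' : (π:ℂ) ≠ 0 := by exact_mod_cast Real.pi_ne_zero
    rw [← mul_assoc]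
    congr 1
    · field_simp
    · congr 1
      field_simp
      ring
  rw [h2, integral_complex_ofReal, integral_const_mul, sq_gauss_int _ (by positivity), ← Complex.ofReal_mul]
  congr 1
  unfold PK
  rw [Real.rpow_neg (by positivity), Real.div_rpow (by positivity) (by positivity)]
  have : (t^2:ℝ) ^ (3/2 : ℝ) = t^3 := by
    rw [← Real.rpow_natCast, ← Real.rpow_mul ht.le, ← Real.rpow_natCast]
    norm_num
  rw [this]
  have : √π ≠ 0 := by positivity
  have : (t^2 + ‖w‖^2) ^ (3/2:ℝ) ≠ 0 := by positivity
  field_simp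
  norm_num

lemma PK_nonneg (t : ℝ) (ht : 0 < t) (x : EuclideanSpace ℝ (Fin 2)) : 0 ≤ PK t x := by
  unfold PK; positivity

lemma PK_cont (t : ℝ) (ht : 0 < t) : Continuous (PK t) := by
  unfold PK
  refine Continuous.div continuous_const ?_ ?_
  · refine continuous_const.mul (Continuous.rpow_const (by fun_prop) ?_)
    intro x; right; norm_num
  · intro x; positivity

lemma PK_int (t : ℝ) (ht : 0 < t) : Integrable (PK t) := by
  have h := (integrable_rpow_neg_one_add_norm_sq (E := EuclideanSpace ℝ (Fin 2)) (μ := volume) (r := 3)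
    (by simp; norm_num)).const_mul (t / (2*π) * (min 1 (t^2)) ^ (-(3/2):ℝ))
  refine Integrable.mono' h (PK_cont t ht).aestronglyMeasurable (Filter.Eventually.of_forall fun x => ?_)
  rw [Real.norm_of_nonneg (PK_nonneg t ht x)]
  have hc : 0 < min 1 (t^2) := lt_min one_pos (by positivity)
  have h1 : min 1 (t^2) * (1 + ‖x‖^2) ≤ t^2 + ‖x‖^2 := by
    have a1 := min_le_left 1 (t^2)
    have a2 := min_le_right 1 (t^2)
    nlinarith [sq_nonneg ‖x‖]
  have h2 := Real.rpow_le_rpow_of_nonpos (by positivity) h1 (z := -(3/2)) (by norm_num)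
  rw [Real.mul_rpow hc.le (by positivity)] at h2
  have h3 : PK t x = t / (2*π) * (t^2 + ‖x‖^2) ^ (-(3/2) : ℝ) := by
    unfold PK
    rw [Real.rpow_neg (by positivity)]
    field_simp
  rw [h3, mul_assoc, show (-3/2 : ℝ) = -(3/2) by norm_num]
  gcongr

lemma E_cont (t : ℝ) : Continuous (fun v : EuclideanSpace ℝ (Fin 2) => (rexp (-2*π*t*‖v‖) : ℂ)) := by
  fun_prop

lemma E_int (t : ℝ) (ht : 0 < t) :
    Integrable (fun v : EuclideanSpace ℝ (Fin 2) => (rexp (-2*π*t*‖v‖) : ℂ)) := by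
  have := (rad_int t ht 0).ofReal (𝕜 := ℂ)
  simpa using this

open FourierTransform in
lemma fourier_PK (t : ℝ) (ht : 0 < t) (v : EuclideanSpace ℝ (Fin 2)) :
    𝓕 (fun w => (PK t w : ℂ)) v = (rexp (-2*π*t*‖v‖) : ℂ) := by
  have h1 := funext (fourier_E t ht)
  have hi : Integrable (fun w => (PK t w : ℂ)) := (PK_int t ht).ofReal
  have h2 := congrFun ((E_cont t).fourierInv_fourier_eq (E_int t ht) (by rw [h1]; exact hi)) (-v)
  rw [h1, Real.fourierInv_eq_fourier_neg, neg_neg, norm_neg] at h2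
  exact h2

lemma PK_total (t : ℝ) (ht : 0 < t) : ∫ y, PK t y = 1 := by
  have h := fourier_PK t ht 0
  rw [Real.fourier_eq'] at h
  simp only [inner_zero_right, mul_zero, Complex.ofReal_zero, zero_mul, Complex.exp_zero, one_smul,
    norm_zero, Real.exp_zero] at h
  rw [integral_complex_ofReal] at h
  exact_mod_cast h

open FourierTransform in
lemma PK_semi (h : ℝ) (hh : 0 < h) (x : EuclideanSpace ℝ (Fin 2)) :
    ∫ y, PK 1 (x + y) * PK h y = PK (1 + h) x := by
  set f : EuclideanSpace ℝ (Fin 2) → ℂ := fun v =>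
    Complex.exp ((↑(-2 * π * inner ℝ v x) * Complex.I)) * (rexp (-2*π*1*‖v‖) : ℂ) with hf
  have hfi : Integrable f := by
    refine Integrable.mono (E_int 1 one_pos) (Continuous.aestronglyMeasurable (by fun_prop))
      (Filter.Eventually.of_forall fun v => ?_)
    rw [hf]; simp only
    rw [norm_mul, Complex.norm_exp_ofReal_mul_I, one_mul]
  have hff : ∀ y, 𝓕 f y = PK 1 (x + y) := by
    intro y
    rw [← fourier_E 1 one_pos, Real.fourier_eq', Real.fourier_eq']
    congr 1
    ext v
    simp only [hf, smul_eq_mul]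
    rw [← mul_assoc, ← Complex.exp_add, inner_add_right]
    congr 2
    push_cast
    ring
  have key := VectorFourier.integral_fourierIntegral_smul_eq_flip (μ := volume) (ν := volume)
    (L := innerₗ (EuclideanSpace ℝ (Fin 2))) (e := Real.fourierChar) (f := f)
    (g := fun w => (PK h w : ℂ)) Real.continuous_fourierChar
    (by simpa using continuous_inner) hfi (PK_int h hh).ofReal
  have k1 : ∀ y, VectorFourier.fourierIntegral Real.fourierChar volume (innerₗ (EuclideanSpace ℝ (Fin 2))) f y
     = PK 1 (x + y) := hff
  have k2 : ∀ y, VectorFourier.fourierIntegral Real.fourierChar volume (innerₗ (EuclideanSpace ℝ (Fin 2))).flip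
     (fun w => (PK h w : ℂ)) y = (rexp (-2*π*h*‖y‖) : ℂ) := by
    intro y
    rw [flip_innerₗ]
    exact fourier_PK h hh y
  simp_rw [k1, k2] at key
  have k3 : ∫ v, f v • (rexp (-2*π*h*‖v‖) : ℂ) = PK (1+h) x := by
    rw [← fourier_E (1+h) (by positivity), Real.fourier_eq']
    congr 1
    ext v
    simp only [hf, smul_eq_mul]
    rw [mul_assoc, ← Complex.ofReal_mul, ← Real.exp_add]
    congr 3
    ring_nf
  rw [k3] at key
  simp only [smul_eq_mul, ← Complex.ofReal_mul] at key
  rw [integral_complex_ofReal] at key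
  exact_mod_cast key

lemma PK_neg (t : ℝ) (x : EuclideanSpace ℝ (Fin 2)) : PK t (-x) = PK t x := by
  unfold PK; rw [norm_neg]

lemma PK_semi' (h : ℝ) (hh : 0 < h) (x : EuclideanSpace ℝ (Fin 2)) :
    ∫ y, PK 1 (x - y) * PK h y = PK (1 + h) x := by
  rw [← PK_semi h hh x, ← integral_neg_eq_self]
  congr 1
  ext y
  rw [PK_neg, sub_neg_eq_add]

open FourierTransform in
lemma D_bound (x : EuclideanSpace ℝ (Fin 2)) : ∃ C : ℝ, 0 ≤ C ∧ ∀ y,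
    |2 * PK 1 x - PK 1 (x+y) - PK 1 (x-y)| ≤ C * ‖y‖^2 := by
  refine ⟨4*π^2 * ∫ v : EuclideanSpace ℝ (Fin 2), ‖v‖^2 * rexp (-2*π*1*‖v‖), ?_, ?_⟩
  · have : 0 ≤ ∫ v : EuclideanSpace ℝ (Fin 2), ‖v‖^2 * rexp (-2*π*1*‖v‖) :=
      integral_nonneg fun v => by positivity
    positivity
  intro y
  have hI : ∀ z : EuclideanSpace ℝ (Fin 2), Integrable (fun v : EuclideanSpace ℝ (Fin 2) =>
      Complex.exp ((↑(-2 * π * inner ℝ v z) * Complex.I)) * (rexp (-2*π*1*‖v‖) : ℂ)) := by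
    intro z
    refine Integrable.mono (E_int 1 one_pos) (Continuous.aestronglyMeasurable (by fun_prop))
      (Filter.Eventually.of_forall fun v => ?_)
    rw [norm_mul, Complex.norm_exp_ofReal_mul_I, one_mul]
  have hF : ∀ z, (PK 1 z : ℂ) = ∫ v : EuclideanSpace ℝ (Fin 2),
      Complex.exp ((↑(-2 * π * inner ℝ v z) * Complex.I)) * (rexp (-2*π*1*‖v‖) : ℂ) := by
    intro z
    rw [← fourier_E 1 one_pos, Real.fourier_eq']
    rfl
  have e : ((2 * PK 1 x - PK 1 (x+y) - PK 1 (x-y) : ℝ) : ℂ) = ∫ v : EuclideanSpace ℝ (Fin 2),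
      (2 * (Complex.exp ((↑(-2 * π * inner ℝ v x) * Complex.I)) * (rexp (-2*π*1*‖v‖) : ℂ))
       - Complex.exp ((↑(-2 * π * inner ℝ v (x+y)) * Complex.I)) * (rexp (-2*π*1*‖v‖) : ℂ)
       - Complex.exp ((↑(-2 * π * inner ℝ v (x-y)) * Complex.I)) * (rexp (-2*π*1*‖v‖) : ℂ)) := by
    rw [integral_sub, integral_sub, integral_const_mul, ← hF, ← hF, ← hF]
    · push_cast
      rfl
    · exact (hI x).const_mul 2
    · exact hI _
    · exact ((hI x).const_mul 2).sub (hI _)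
    · exact hI _
  rw [← Real.norm_eq_abs, ← Complex.norm_real, e, mul_comm _ (‖y‖^2), ← integral_const_mul,
    ← integral_const_mul]
  refine norm_integral_le_of_norm_le (((rad_int 1 one_pos 2).const_mul _).const_mul _)
    (Filter.Eventually.of_forall fun v => ?_)
  set θ : ℝ := 2 * π * inner ℝ v y with hθ
  have e2 : (2 * (Complex.exp ((↑(-2 * π * inner ℝ v x) * Complex.I)) * (rexp (-2*π*1*‖v‖) : ℂ))
       - Complex.exp ((↑(-2 * π * inner ℝ v (x+y)) * Complex.I)) * (rexp (-2*π*1*‖v‖) : ℂ)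
       - Complex.exp ((↑(-2 * π * inner ℝ v (x-y)) * Complex.I)) * (rexp (-2*π*1*‖v‖) : ℂ))
      = Complex.exp ((↑(-2 * π * inner ℝ v x) * Complex.I)) * (((2 - 2 * Real.cos θ) * rexp (-2*π*1*‖v‖) : ℝ) : ℂ) := by
    have h1 : Complex.exp ((↑(-2 * π * inner ℝ v (x+y)) * Complex.I)) =
       Complex.exp ((↑(-2 * π * inner ℝ v x) * Complex.I)) * Complex.exp (-θ * Complex.I) := by
      rw [← Complex.exp_add, inner_add_right, hθ]
      congr 1
      push_cast
      ring
    have h2 : Complex.exp ((↑(-2 * π * inner ℝ v (x-y)) * Complex.I)) =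
       Complex.exp ((↑(-2 * π * inner ℝ v x) * Complex.I)) * Complex.exp (θ * Complex.I) := by
      rw [← Complex.exp_add, inner_sub_right, hθ]
      congr 1
      push_cast
      ring
    have h3 := Complex.two_cos (θ : ℂ)
    rw [h1, h2]
    push_cast
    rw [h3]
    ring
  rw [e2, norm_mul, Complex.norm_exp_ofReal_mul_I, one_mul, Complex.norm_real, norm_mul,
    Real.norm_of_nonneg (Real.exp_pos _).le, Real.norm_of_nonneg (by linarith [Real.cos_le_one θ])]
  have c1 := Real.one_sub_sq_div_two_le_cos (x := θ)
  have c2 : θ^2 ≤ 4*π^2 * (‖v‖^2 * ‖y‖^2) := by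
    have := abs_real_inner_le_norm v y
    have h4 : (inner ℝ v y)^2 ≤ (‖v‖*‖y‖)^2 := by
      rw [← sq_abs]; gcongr
    rw [hθ]
    have : 0 < π^2 := by positivity
    nlinarith
  calc (2 - 2 * Real.cos θ) * rexp (-2*π*1*‖v‖) ≤ (4*π^2 * (‖v‖^2 * ‖y‖^2)) * rexp (-2*π*1*‖v‖) := by
        gcongr; linarith
    _ = _ := by ring

lemma PK_deriv (x : EuclideanSpace ℝ (Fin 2)) :
    HasDerivAt (fun t => PK t x) (-((2 - ‖x‖ ^ 2) / (2 * π * (1 + ‖x‖ ^ 2) ^ ((5 : ℝ) / 2)))) 1 := by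
  unfold PK
  have h1 : HasDerivAt (fun t : ℝ => t^2 + ‖x‖^2) 2 1 := by
    simpa using ((hasDerivAt_pow 2 (1:ℝ)).add_const (‖x‖^2))
  have h2 := (h1.rpow_const (p := 3/2) (Or.inr (by norm_num))).const_mul (2*π)
  have hA : 0 < 1 + ‖x‖^2 := by positivity
  have h3 := (hasDerivAt_id (1:ℝ)).div h2 (by positivity)
  refine HasDerivAt.congr_deriv h3 ?_
  simp only [id, one_pow]
  set A := 1 + ‖x‖^2 with hAd
  have hx : ‖x‖^2 = A - 1 := by rw [hAd]; ring
  rw [hx]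
  have p1 : A ^ ((3/2 - 1 : ℝ)) = √A := by rw [Real.sqrt_eq_rpow]; norm_num
  have p2 : A ^ ((3/2 : ℝ)) = A * √A := by
    rw [Real.sqrt_eq_rpow, show (3/2:ℝ) = 1 + 1/2 by norm_num, Real.rpow_add hA, Real.rpow_one]
  have p3 : A ^ ((5/2 : ℝ)) = A^2 * √A := by
    rw [Real.sqrt_eq_rpow, show (5/2:ℝ) = 2 + 1/2 by norm_num, Real.rpow_add hA, Real.rpow_two]
  rw [p1, p2, p3]
  have : √A ≠ 0 := by positivity
  have hA' : A ≠ 0 := hA.ne'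
  field_simp
  ring

lemma B_int : Integrable (fun y : EuclideanSpace ℝ (Fin 2) => (‖y‖ * (1 + ‖y‖^2))⁻¹) := by
  refine (integrable_fun_norm_addHaar (volume : Measure (EuclideanSpace ℝ (Fin 2)))
    (f := fun r => (r * (1 + r^2))⁻¹)).2 ?_
  refine (integrable_inv_one_add_sq.integrableOn (s := Set.Ioi 0)).congr_fun ?_ measurableSet_Ioi
  intro r hr
  have hr0 : 0 < r := hr
  simp only [finrank_euclideanSpace, Fintype.card_fin, smul_eq_mul]
  norm_num
  field_simp

lemma PK_le (x : EuclideanSpace ℝ (Fin 2)) : PK 1 x ≤ 1 := by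
  unfold PK
  have h1 : 1 ≤ ((1:ℝ)^2 + ‖x‖^2) ^ ((3:ℝ)/2) := by
    apply Real.one_le_rpow
    · nlinarith [sq_nonneg ‖x‖]
    · norm_num
  have h2 := Real.pi_gt_three
  rw [div_le_one (by positivity)]
  nlinarith

open Filter Topology in
lemma main_int (x : EuclideanSpace ℝ (Fin 2)) :
    ∫ y, (2 * PK 1 x - PK 1 (x+y) - PK 1 (x-y)) / ‖y‖^3
      = 4 * π * ((2 - ‖x‖ ^ 2) / (2 * π * (1 + ‖x‖ ^ 2) ^ ((5 : ℝ) / 2))) := by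
  set D : EuclideanSpace ℝ (Fin 2) → ℝ := fun y => 2 * PK 1 x - PK 1 (x+y) - PK 1 (x-y) with hD
  have hDc : Continuous D := by
    have := PK_cont 1 one_pos
    fun_prop
  obtain ⟨C, hC0, hC⟩ := D_bound x
  have hB : ∀ y, |D y| * (1 + ‖y‖^2) ≤ (C + 4) * ‖y‖^2 := by
    intro y
    have h1 : |D y| ≤ C * ‖y‖^2 := hC y
    have h2 : |D y| ≤ 4 := by
      have a1 := PK_le x
      have a2 := PK_le (x+y)
      have a3 := PK_le (x-y)
      have b1 := PK_nonneg 1 one_pos x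
      have b2 := PK_nonneg 1 one_pos (x+y)
      have b3 := PK_nonneg 1 one_pos (x-y)
      rw [abs_le]
      simp only [hD]
      constructor <;> linarith
    nlinarith [sq_nonneg ‖y‖]
  have hval : ∀ h : ℝ, 0 < h → ∫ y, D y / (h^2 + ‖y‖^2) ^ ((3:ℝ)/2) =
      -(4 * π) * (h⁻¹ * (PK (1+h) x - PK 1 x)) := by
    intro h hh
    have i0 : Integrable (fun y => 2 * PK 1 x * PK h y) := (PK_int h hh).const_mul _
    have ib : ∀ g : EuclideanSpace ℝ (Fin 2) → EuclideanSpace ℝ (Fin 2), Continuous g →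
        Integrable (fun y => PK 1 (g y) * PK h y) := by
      intro g hg
      refine Integrable.mono' (PK_int h hh) (((PK_cont 1 one_pos).comp hg).mul (PK_cont h hh)).aestronglyMeasurable
        (Eventually.of_forall fun y => ?_)
      have a1 := PK_le (g y)
      have a2 := PK_nonneg 1 one_pos (g y)
      have a3 := PK_nonneg h hh y
      rw [Real.norm_of_nonneg (mul_nonneg a2 a3)]
      nlinarith
    have i1 := ib (fun y => x + y) (by fun_prop)
    have i2 := ib (fun y => x - y) (by fun_prop)
    have e : ∀ y, D y / (h^2 + ‖y‖^2) ^ ((3:ℝ)/2) = (2*π/h) *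
        (2 * PK 1 x * PK h y - PK 1 (x+y) * PK h y - PK 1 (x-y) * PK h y) := by
      intro y
      rw [← sub_mul, ← sub_mul]
      simp only [hD]
      generalize (2 * PK 1 x - PK 1 (x+y) - PK 1 (x-y)) = q
      unfold PK
      have : (h^2 + ‖y‖^2) ^ ((3:ℝ)/2) ≠ 0 := by positivity
      field_simp
    simp_rw [e]
    rw [integral_const_mul, integral_sub, integral_sub i0 i1, integral_const_mul, PK_total h hh,
      PK_semi h hh, PK_semi' h hh]
    · field_simp
      ring
    · exact i0.sub i1
    · exact i2
  have hlim1 : Tendsto (fun h : ℝ => ∫ y, D y / (h^2 + ‖y‖^2) ^ ((3:ℝ)/2)) (𝓝[>] 0)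
      (𝓝 (∫ y, D y / ‖y‖^3)) := by
    have hpow : ∀ r : ℝ, 0 ≤ r → (r^2) ^ ((3:ℝ)/2) = r^3 := by
      intro r hr
      rw [← Real.rpow_natCast, ← Real.rpow_mul hr, ← Real.rpow_natCast]
      norm_num
    have hae : ∀ᵐ y : EuclideanSpace ℝ (Fin 2), y ≠ 0 := by
      rw [ae_iff]; simp
    refine tendsto_integral_filter_of_dominated_convergence
      (fun y => (C+4) * (‖y‖ * (1 + ‖y‖^2))⁻¹) ?_ ?_ (B_int.const_mul _) ?_
    · filter_upwards [self_mem_nhdsWithin] with h hh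
      exact (hDc.measurable.div (by fun_prop)).aestronglyMeasurable
    · filter_upwards [self_mem_nhdsWithin] with h hh
      filter_upwards [hae] with y hy
      have hy0 : 0 < ‖y‖ := norm_pos_iff.2 hy
      have h1 : ‖y‖^3 ≤ (h^2 + ‖y‖^2) ^ ((3:ℝ)/2) := by
        rw [← hpow _ hy0.le]
        apply Real.rpow_le_rpow (by positivity) (by nlinarith [sq_nonneg h]) (by norm_num)
      rw [norm_div, Real.norm_eq_abs, Real.norm_of_nonneg (by positivity)]
      calc |D y| / (h^2 + ‖y‖^2) ^ ((3:ℝ)/2) ≤ |D y| / ‖y‖^3 := by gcongr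
        _ ≤ _ := by
          rw [← div_eq_mul_inv, div_le_div_iff₀ (by positivity) (by positivity)]
          have := hB y
          calc |D y| * (‖y‖ * (1 + ‖y‖^2)) = ‖y‖ * (|D y| * (1 + ‖y‖^2)) := by ring
            _ ≤ ‖y‖ * ((C + 4) * ‖y‖^2) := by gcongr
            _ = _ := by ring
    · filter_upwards [hae] with y hy
      have hy0 : 0 < ‖y‖ := norm_pos_iff.2 hy
      have hc : ContinuousAt (fun h : ℝ => D y / (h^2 + ‖y‖^2) ^ ((3:ℝ)/2)) 0 := by
        refine ContinuousAt.div continuousAt_const ?_ (by positivity)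
        refine ContinuousAt.rpow_const (by fun_prop) (Or.inr (by norm_num))
      have := hc.tendsto.mono_left (nhdsWithin_le_nhds (s := Set.Ioi 0))
      simp only [ne_eq, OfNat.ofNat_ne_zero, not_false_eq_true, zero_pow, zero_add] at this
      rwa [hpow _ hy0.le] at this
  have hlim2 : Tendsto (fun h : ℝ => ∫ y, D y / (h^2 + ‖y‖^2) ^ ((3:ℝ)/2)) (𝓝[>] 0)
      (𝓝 (-(4 * π) * (-((2 - ‖x‖ ^ 2) / (2 * π * (1 + ‖x‖ ^ 2) ^ ((5 : ℝ) / 2)))))) := by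
    have h1 := (hasDerivAt_iff_tendsto_slope_zero.1 (PK_deriv x)).mono_left
      (nhdsWithin_mono 0 (fun a (ha : a ∈ Set.Ioi (0:ℝ)) => (Set.mem_Ioi.1 ha).ne'))
    refine (h1.const_mul (-(4*π))).congr' ?_
    filter_upwards [self_mem_nhdsWithin] with h hh
    rw [hval h hh, smul_eq_mul]
  rw [tendsto_nhds_unique hlim1 hlim2]
  ring

/-- the half-Laplacian of the dipole potential
`W_Z(x) = Z/(2π(1+|x|²)^{3/2})` equals `Z(2-|x|²)/(2π(1+|x|²)^{5/2})`,
which changes sign on `ℝ²`. -/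
theorem half_laplacian_dipole (Z : ℝ) (hZ : 0 < Z) :
    (∀ x : EuclideanSpace ℝ (Fin 2),
      (1 / (4 * π)) * ∫ y : EuclideanSpace ℝ (Fin 2),
          (2 * (Z / (2 * π * (1 + ‖x‖ ^ 2) ^ ((3 : ℝ) / 2)))
            - Z / (2 * π * (1 + ‖x + y‖ ^ 2) ^ ((3 : ℝ) / 2))
            - Z / (2 * π * (1 + ‖x - y‖ ^ 2) ^ ((3 : ℝ) / 2))) / ‖y‖ ^ 3
        = Z * (2 - ‖x‖ ^ 2) / (2 * π * (1 + ‖x‖ ^ 2) ^ ((5 : ℝ) / 2))) ∧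
    (∃ a b : EuclideanSpace ℝ (Fin 2),
      0 < Z * (2 - ‖a‖ ^ 2) / (2 * π * (1 + ‖a‖ ^ 2) ^ ((5 : ℝ) / 2)) ∧
      Z * (2 - ‖b‖ ^ 2) / (2 * π * (1 + ‖b‖ ^ 2) ^ ((5 : ℝ) / 2)) < 0) := by
  constructor
  · intro x
    have e : ∀ y : EuclideanSpace ℝ (Fin 2),
        (2 * (Z / (2 * π * (1 + ‖x‖ ^ 2) ^ ((3 : ℝ) / 2)))
            - Z / (2 * π * (1 + ‖x + y‖ ^ 2) ^ ((3 : ℝ) / 2))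
            - Z / (2 * π * (1 + ‖x - y‖ ^ 2) ^ ((3 : ℝ) / 2))) / ‖y‖ ^ 3
        = Z * ((2 * PK 1 x - PK 1 (x+y) - PK 1 (x-y)) / ‖y‖^3) := by
      intro y
      unfold PK
      rw [one_pow]
      ring
    simp_rw [e]
    rw [integral_const_mul, main_int x]
    field_simp
  · refine ⟨0, EuclideanSpace.single 0 2, ?_, ?_⟩
    · rw [norm_zero]
      apply div_pos
      · nlinarith
      · positivity
    · rw [EuclideanSpace.norm_single]
      apply div_neg_of_neg_of_pos
      · norm_num
        nlinarith
      · positivity
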